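/- arXiv:0705.4374 — 3 statements merged into one kernel-verified Lean document; each statement's English description precedes it below -/
import Mathlib

section
/- Let φ₁,…,φ_N : ℝ^d → ℝ be differentiable functions forming a partition of unity (Σ_{j=1}^N φ_j(x) = 1 for every x ∈ ℝ^d). Let x₁,…,x_N, v₁,…,v_N ∈ ℝ^d, let m_i > 0, ρ_i > 0 and P_i ∈ ℝ for each i. Then Σ_{i=1}^N [ v_i · ( Σ_{j=1}^N (m_j/ρ_j) P_j ∇φ_i(x_j) ) − (m_i P_i/ρ_i) Σ_{j=1}^N (v_j − v_i) · ∇φ_j(x_i) ] = 0. Consequently, under the discrete continuity equation dρ_i/dt = −ρ_i Σ_j (v_j − v_i)·∇φ_j(x_i), the thermal-energy equation de_i/dt = (P_i/ρ_i²) dρ_i/dt and the equations of motion m_i dv_i/dt = Σ_j (m_j/ρ_j) P_j ∇φ_i(x_j), the total energy Σ_i m_i (|v_i|²/2 + e_i) has zero time derivative. -/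
open scoped BigOperators RealInnerProductSpace

/-- The gradients of differentiable functions with constant sum add up to zero. -/
theorem sum_gradient_eq_zero_of_sum_eq_const {ι E : Type*} [Fintype ι] [NormedAddCommGroup E]
    [InnerProductSpace ℝ E] [CompleteSpace E] {φ : ι → E → ℝ} {c : ℝ} {y : E}
    (hφ : ∀ i, DifferentiableAt ℝ (φ i) y) (hc : ∀ z, ∑ j, φ j z = c) :
    ∑ j, gradient (φ j) y = 0 := by
  have h : ∑ j, fderiv ℝ (φ j) y = 0 := by
    rw [← fderiv_fun_sum fun i _ => hφ i]
    simp [hc]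
  simp only [gradient]
  rw [← map_sum, h, map_zero]

/-- If the vectors `g j i` sum to zero over `j`, the pressure work on the velocities `v` balances
the work done by the relative velocities `v j - v i`. -/
theorem sum_inner_sum_smul_sub_eq_zero {ι E : Type*} [Fintype ι] [NormedAddCommGroup E]
    [InnerProductSpace ℝ E] (g : ι → ι → E) (hg : ∀ i, ∑ j, g j i = 0) (v : ι → E) (c : ι → ℝ) :
    ∑ i, (⟪v i, ∑ j, c j • g i j⟫ - c i * ∑ j, ⟪v j - v i, g j i⟫) = 0 := by
  have h (i : ι) : ∑ j, ⟪v j - v i, g j i⟫ = ∑ j, ⟪v j, g j i⟫ := by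
    simp only [inner_sub_left, Finset.sum_sub_distrib]
    rw [← inner_sum, hg, inner_zero_right, sub_zero]
  simp only [h, inner_sum, inner_smul_right, Finset.mul_sum, Finset.sum_sub_distrib]
  rw [Finset.sum_comm, sub_self]

/-- For differentiable shape functions forming a partition of unity,
the identity
`∑ i, (⟪v i, ∑ j, (m j / ρ j * P j) • ∇φ i (x j)⟫ − (m i * P i / ρ i) * ∑ j, ⟪v j − v i, ∇φ j (x i)⟫) = 0`
holds; consequently, under the discrete continuity equation, the thermal-energy equation
and the equations of motion, the total energy `∑ i, m i * (‖v i‖² / 2 + e i)` has zero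
time derivative. -/
theorem stmt1 (d N : ℕ) (φ : Fin N → EuclideanSpace ℝ (Fin d) → ℝ)
    (hφ : ∀ i, Differentiable ℝ (φ i))
    (hpu : ∀ y : EuclideanSpace ℝ (Fin d), ∑ j, φ j y = 1)
    (x v : Fin N → EuclideanSpace ℝ (Fin d)) (m ρ P : Fin N → ℝ)
    (hm : ∀ i, 0 < m i) (hρ : ∀ i, 0 < ρ i) :
    (∑ i, (⟪v i, ∑ j, (m j / ρ j * P j) • gradient (φ i) (x j)⟫ -
        (m i * P i / ρ i) * ∑ j, ⟪v j - v i, gradient (φ j) (x i)⟫)) = 0 ∧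
    ∀ (vel : Fin N → ℝ → EuclideanSpace ℝ (Fin d)) (en : Fin N → ℝ → ℝ)
      (a : Fin N → EuclideanSpace ℝ (Fin d)) (Dρ : Fin N → ℝ) (t : ℝ),
      (∀ i, vel i t = v i) →
      (∀ i, Dρ i = -ρ i * ∑ j, ⟪v j - v i, gradient (φ j) (x i)⟫) →
      (∀ i, m i • a i = ∑ j, (m j / ρ j * P j) • gradient (φ i) (x j)) →
      (∀ i, HasDerivAt (vel i) (a i) t) →
      (∀ i, HasDerivAt (en i) (P i / ρ i ^ 2 * Dρ i) t) →
      HasDerivAt (fun s => ∑ i, m i * (‖vel i s‖ ^ 2 / 2 + en i s)) 0 t := by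
  have key : ∑ i, (⟪v i, ∑ j, (m j / ρ j * P j) • gradient (φ i) (x j)⟫ -
      (m i * P i / ρ i) * ∑ j, ⟪v j - v i, gradient (φ j) (x i)⟫) = 0 := by
    have h := sum_inner_sum_smul_sub_eq_zero (fun i j => gradient (φ i) (x j))
      (fun i => sum_gradient_eq_zero_of_sum_eq_const (fun j => hφ j (x i)) hpu) v
      (fun i => m i / ρ i * P i)
    simpa only [div_mul_eq_mul_div] using h
  refine ⟨key, fun vel en a Dρ t hv hD ha hvel hen => ?_⟩
  have h := HasDerivAt.fun_sum (u := Finset.univ) fun i _ =>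
    (((hvel i).norm_sq.div_const 2).add (hen i)).const_mul (m i)
  refine h.congr_deriv (Eq.trans (Finset.sum_congr rfl fun i _ => ?_) key)
  have hρi := (hρ i).ne'
  rw [← ha i, hD i, hv i, inner_smul_right]
  field_simp
  ring
end

section
/- Let φ₁,…,φ_N : ℝ³ → ℝ be differentiable functions associated with points x₁,…,x_N ∈ ℝ³ satisfying, for every y ∈ ℝ³, Σ_{j=1}^N φ_j(y) = 1 and Σ_{j=1}^N x_j φ_j(y) = y. Let V₁,…,V_N and P₁,…,P_N be real numbers. Then Σ_{i=1}^N x_i × ( Σ_{j=1}^N V_j P_j ∇φ_i(x_j) ) = 0. Consequently, under the equations of motion m_i dv_i/dt = Σ_j V_j P_j ∇φ_i(x_j), the total angular momentum Σ_i m_i x_i × v_i is explicitly conserved. -/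
open scoped BigOperators

/-- The cross product on `ℝ³ = EuclideanSpace ℝ (Fin 3)`. -/
noncomputable def cross3 (a b : EuclideanSpace ℝ (Fin 3)) : EuclideanSpace ℝ (Fin 3) :=
  (WithLp.equiv 2 (Fin 3 → ℝ)).symm
    (crossProduct ((WithLp.equiv 2 (Fin 3 → ℝ)) a) ((WithLp.equiv 2 (Fin 3 → ℝ)) b))

theorem cross3_eq (a b : EuclideanSpace ℝ (Fin 3)) :
    cross3 a b = !₂[a 1 * b 2 - a 2 * b 1, a 2 * b 0 - a 0 * b 2, a 0 * b 1 - a 1 * b 0] := by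
  simp [cross3, cross_apply]

@[simp]
theorem cross3_self (a : EuclideanSpace ℝ (Fin 3)) : cross3 a a = 0 := by
  simp [cross3]

/-- The cross product as a continuous bilinear map. -/
noncomputable def crossCLM :
    EuclideanSpace ℝ (Fin 3) →L[ℝ] EuclideanSpace ℝ (Fin 3) →L[ℝ] EuclideanSpace ℝ (Fin 3) :=
  (LinearMap.mk₂ ℝ cross3 (fun _ _ _ => by simp [cross3]) (fun _ _ _ => by simp [cross3])
    (fun _ _ _ => by simp [cross3]) (fun _ _ _ => by simp [cross3])).toContinuousBilinearMap

theorem crossCLM_apply (a b : EuclideanSpace ℝ (Fin 3)) : crossCLM a b = cross3 a b := rfl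

theorem HasDerivAt.cross3 {f g : ℝ → EuclideanSpace ℝ (Fin 3)}
    {f' g' : EuclideanSpace ℝ (Fin 3)} {t : ℝ} (hf : HasDerivAt f f' t) (hg : HasDerivAt g g' t) :
    HasDerivAt (fun s => cross3 (f s) (g s)) (cross3 (f t) g' + cross3 f' (g t)) t :=
  crossCLM.hasDerivAt_of_bilinear (fun _ => hf) (fun _ => hg)

/-- Differentiating linear reproduction `∑ j, φ j y • x j = y` gives
`∑ j, ∂ₖ φ j y * (x j) l = δₖₗ`. -/
theorem sum_gradient_mul_eq_ite {ι n : Type*} [Fintype ι] [Fintype n] [DecidableEq n]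
    {φ : ι → EuclideanSpace ℝ n → ℝ} {x : ι → EuclideanSpace ℝ n}
    (hφ : ∀ j, Differentiable ℝ (φ j)) (hlin : ∀ y, ∑ j, φ j y • x j = y)
    (y : EuclideanSpace ℝ n) (k l : n) :
    ∑ j, gradient (φ j) y k * x j l = if l = k then 1 else 0 := by
  have hsum : HasFDerivAt (fun z => ∑ j, φ j z • x j)
      (∑ j, (fderiv ℝ (φ j) y).smulRight (x j)) y :=
    HasFDerivAt.fun_sum fun j _ => (hφ j y).hasFDerivAt.smul_const (x j)
  simp_rw [hlin] at hsum
  have happly := congrArg (fun L => L (EuclideanSpace.single k 1) l)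
    (hsum.unique (hasFDerivAt_id y))
  have hgrad (j : ι) : gradient (φ j) y k = fderiv ℝ (φ j) y (EuclideanSpace.single k 1) := by
    rw [gradient, ← InnerProductSpace.toDual_symm_apply (𝕜 := ℝ), EuclideanSpace.inner_single_right]
    simp
  simpa [hgrad, Pi.single_apply] using happly

theorem sum_cross3_gradient_eq_zero {ι : Type*} [Fintype ι]
    {φ : ι → EuclideanSpace ℝ (Fin 3) → ℝ} {x : ι → EuclideanSpace ℝ (Fin 3)}
    (hφ : ∀ j, Differentiable ℝ (φ j)) (hlin : ∀ y, ∑ j, φ j y • x j = y)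
    (y : EuclideanSpace ℝ (Fin 3)) :
    ∑ i, cross3 (x i) (gradient (φ i) y) = 0 := by
  have hsum (k l : Fin 3) :
      ∑ i, x i l * gradient (φ i) y k = if l = k then 1 else 0 := by
    simpa only [mul_comm] using sum_gradient_mul_eq_ite hφ hlin y k l
  ext l
  fin_cases l <;> simp [cross3_eq, Finset.sum_sub_distrib, hsum]

/-- If differentiable shape functions `φ₁, …, φ_N : ℝ³ → ℝ` form a
partition of unity and reproduce linear polynomials with respect to the points
`x₁, …, x_N`, then for any volumes `V j` and pressures `P j`,
`∑ i, x i × (∑ j, V j * P j • ∇φ i (x j)) = 0`; consequently, under the equations of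
motion `m i • (dv i / dt) = ∑ j, V j * P j • ∇φ i (x j)`, the total angular momentum
`∑ i, m i • (x i × v i)` has zero time derivative. -/
theorem stmt3 (N : ℕ) (φ : Fin N → EuclideanSpace ℝ (Fin 3) → ℝ)
    (x : Fin N → EuclideanSpace ℝ (Fin 3))
    (hφ : ∀ j, Differentiable ℝ (φ j))
    (hpu : ∀ y : EuclideanSpace ℝ (Fin 3), ∑ j, φ j y = 1)
    (hlin : ∀ y : EuclideanSpace ℝ (Fin 3), ∑ j, φ j y • x j = y)
    (V P m : Fin N → ℝ) :
    (∑ i, cross3 (x i) (∑ j, (V j * P j) • gradient (φ i) (x j))) = 0 ∧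
    ∀ (pos vel : Fin N → ℝ → EuclideanSpace ℝ (Fin 3))
      (v a : Fin N → EuclideanSpace ℝ (Fin 3)) (t : ℝ),
      (∀ i, pos i t = x i) → (∀ i, vel i t = v i) →
      (∀ i, HasDerivAt (pos i) (v i) t) →
      (∀ i, HasDerivAt (vel i) (a i) t) →
      (∀ i, m i • a i = ∑ j, (V j * P j) • gradient (φ i) (x j)) →
      HasDerivAt (fun s => ∑ i, m i • cross3 (pos i s) (vel i s)) 0 t := by
  have hforce : ∑ i, cross3 (x i) (∑ j, (V j * P j) • gradient (φ i) (x j)) = 0 := by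
    simp_rw [← crossCLM_apply, map_sum, map_smul]
    rw [Finset.sum_comm]
    simp_rw [← Finset.smul_sum, crossCLM_apply, sum_cross3_gradient_eq_zero hφ hlin, smul_zero,
      Finset.sum_const_zero]
  refine ⟨hforce, fun pos vel v a t hpos hvel hdpos hdvel hmotion => ?_⟩
  have hzero : ∑ i, m i • (cross3 (pos i t) (a i) + cross3 (v i) (vel i t)) = 0 := by
    simp_rw [hpos, hvel, cross3_self, add_zero, ← crossCLM_apply, ← map_smul, hmotion,
      crossCLM_apply, hforce]
  rw [← hzero]
  exact HasDerivAt.fun_sum fun i _ => ((hdpos i).cross3 (hdvel i)).const_smul (m i)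
end

section
/- Let x₁,…,x_N ∈ ℝ^d be distinct points, let v₁,…,v_N ∈ ℝ^d, let m_i > 0, ρ_i > 0, P_i ∈ ℝ, h_i ∈ ℝ for each i, and let k : ℝ × ℝ → ℝ be any function. Define G(i,j,h) = k(|x_i − x_j|, h)(x_i − x_j) for i ≠ j and G(i,i,h) = 0. Define a_i = −(1/ρ_i) Σ_{j=1}^N (m_j/ρ_j) [ P_i G(i,j,h_i) + P_j G(i,j,h_j) ], Dρ_i = −ρ_i Σ_{j=1}^N (m_j/ρ_j) (v_j − v_i) · G(i,j,h_i), and De_i = (P_i/ρ_i²) Dρ_i. Then Σ_{i=1}^N m_i ( v_i · a_i + De_i ) = 0; that is, the variationally-consistent SPH equations conserve the total energy Σ_i m_i (|v_i|²/2 + e_i). -/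
open scoped BigOperators RealInnerProductSpace

/-- For distinct particle positions `x i`, velocities `v i`, masses
`m i > 0`, densities `ρ i > 0`, pressures `P i`, smoothing-lengths `h i`, and any
kernel-gradient factor `k : ℝ × ℝ → ℝ`, with `G i j h = k (‖x i - x j‖, h) • (x i - x j)`
for `i ≠ j` and `G i i h = 0`, defining
`a i = -(1/ρ i) • ∑ j, (m j / ρ j) • (P i • G i j (h i) + P j • G i j (h j))`,
`Dρ i = -ρ i * ∑ j, (m j / ρ j) * ⟪v j - v i, G i j (h i)⟫` and
`De i = (P i / ρ i ^ 2) * Dρ i`, we have `∑ i, m i * (⟪v i, a i⟫ + De i) = 0`;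
i.e. the variationally-consistent SPH equations conserve the total energy
`∑ i, m i * (‖v i‖² / 2 + e i)`. -/
theorem stmt6 (d N : ℕ) (x v : Fin N → EuclideanSpace ℝ (Fin d))
    (hx : Function.Injective x)
    (m ρ P h : Fin N → ℝ) (hm : ∀ i, 0 < m i) (hρ : ∀ i, 0 < ρ i)
    (k : ℝ × ℝ → ℝ) (G : Fin N → Fin N → ℝ → EuclideanSpace ℝ (Fin d))
    (hG : ∀ i j s, i ≠ j → G i j s = k (‖x i - x j‖, s) • (x i - x j))
    (hGdiag : ∀ i s, G i i s = 0)
    (a : Fin N → EuclideanSpace ℝ (Fin d)) (Dρ De : Fin N → ℝ)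
    (ha : ∀ i, a i = -(ρ i)⁻¹ •
      ∑ j, (m j / ρ j) • (P i • G i j (h i) + P j • G i j (h j)))
    (hDρ : ∀ i, Dρ i = -ρ i * ∑ j, (m j / ρ j) * ⟪v j - v i, G i j (h i)⟫)
    (hDe : ∀ i, De i = P i / ρ i ^ 2 * Dρ i) :
    ∑ i, m i * (⟪v i, a i⟫ + De i) = 0 := by
  have hanti : ∀ i j s, G i j s = -G j i s := by
    intro i j s
    rcases eq_or_ne i j with rfl | hij
    · simp [hGdiag]
    · rw [hG i j s hij, hG j i s hij.symm, norm_sub_rev, ← smul_neg, neg_sub]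
  have hterm : ∀ i, m i * (⟪v i, a i⟫ + De i) =
      ∑ j, (m i / ρ i * (m j / ρ j) * (P j * ⟪v i, G j i (h j)⟫) -
        m i / ρ i * (m j / ρ j) * (P i * ⟪v j, G i j (h i)⟫)) := by
    intro i
    have hi := (hρ i).ne'
    rw [hDe, hDρ, ha, inner_smul_right, inner_sum, Finset.mul_sum, Finset.mul_sum,
      Finset.mul_sum, ← Finset.sum_add_distrib, Finset.mul_sum]
    refine Finset.sum_congr rfl fun j _ => ?_
    rw [hanti i j (h j), inner_smul_right, inner_add_right, inner_smul_right,
      inner_smul_right, inner_neg_right, inner_sub_left]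
    field_simp
    ring
  simp_rw [hterm, Finset.sum_sub_distrib]
  rw [sub_eq_zero, Finset.sum_comm]
  refine Finset.sum_congr rfl fun i _ => Finset.sum_congr rfl fun j _ => ?_
  ring
end
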